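/- arXiv:2511.00931 — 2 statements merged into one kernel-verified Lean document; each statement's English description precedes it below -/
import Mathlib

section
/- Let f : Ω×ℝ → ℝ be continuous, let g : ℝ → ℝ be continuous satisfying (g₀), and suppose M, N satisfy (h₁) with exponent α ∈ ℝ and (h₂) with exponent β ∈ ℕ ∪ {0}. If v ∈ C²(Ω) satisfies M(x, Dv, D²v) + h(x, v) = 0 at every point of Ω, where h(x, s) = e^{(α+β+1)G(Φ_g⁻¹(s))} f(x, Φ_g⁻¹(s)), then u = Φ_g⁻¹ ∘ v satisfies M(x, Du, D²u) + g(u) N(x, Du, D²u) + f(x, u) = 0 at every point of Ω. -/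
open Real Filter Set

/-- Gradient of `u` at `x` (vector of partial derivatives). -/
noncomputable def vgrad {n : ℕ} (u : (Fin n → ℝ) → ℝ) (x : Fin n → ℝ) : Fin n → ℝ :=
  fun i => fderiv ℝ u x (Pi.single i 1)

/-- Hessian matrix of `u` at `x`. -/
noncomputable def vhess {n : ℕ} (u : (Fin n → ℝ) → ℝ) (x : Fin n → ℝ) :
    Matrix (Fin n) (Fin n) ℝ :=
  Matrix.of fun i j => fderiv ℝ (fun y => fderiv ℝ u y (Pi.single j 1)) x (Pi.single i 1)

noncomputable def Gg (g : ℝ → ℝ) (s : ℝ) : ℝ := ∫ τ in (0:ℝ)..s, g τ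

noncomputable def Phig (g : ℝ → ℝ) (t : ℝ) : ℝ := ∫ s in (0:ℝ)..t, Real.exp (Gg g s)

/-- Condition `(g₀)`. -/
def g0cond (g : ℝ → ℝ) : Prop :=
  ∃ s₀ : ℝ, 0 ≤ s₀ ∧ (∀ s, s₀ ≤ s → 0 ≤ g s) ∧ (∀ s, s ≤ -s₀ → g s ≤ 0)

theorem Gg_hasDerivAt (g : ℝ → ℝ) (hg : Continuous g) (s : ℝ) : HasDerivAt (Gg g) (g s) s :=
  intervalIntegral.integral_hasDerivAt_right (hg.intervalIntegrable _ _)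
    (hg.stronglyMeasurableAtFilter _ _) hg.continuousAt

theorem Gg_continuous (g : ℝ → ℝ) (hg : Continuous g) : Continuous (Gg g) :=
  continuous_iff_continuousAt.2 fun s => (Gg_hasDerivAt g hg s).continuousAt

theorem Phig_hasDerivAt (g : ℝ → ℝ) (hg : Continuous g) (s : ℝ) :
    HasDerivAt (Phig g) (Real.exp (Gg g s)) s := by
  have hc : Continuous (fun s => Real.exp (Gg g s)) := Real.continuous_exp.comp (Gg_continuous g hg)
  exact intervalIntegral.integral_hasDerivAt_right (hc.intervalIntegrable _ _)
    (hc.stronglyMeasurableAtFilter _ _) hc.continuousAt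

theorem Phinv_hasDerivAt (g : ℝ → ℝ) (hg : Continuous g)
    (Φinv : ℝ → ℝ) (hleft : ∀ t : ℝ, Φinv (Phig g t) = t)
    (hright : ∀ s : ℝ, Phig g (Φinv s) = s) (s : ℝ) :
    HasDerivAt Φinv (Real.exp (-Gg g (Φinv s))) s := by
  have hmono : StrictMono (Phig g) := by
    apply strictMono_of_deriv_pos
    intro x
    rw [(Phig_hasDerivAt g hg x).deriv]
    exact Real.exp_pos _
  have hm : Monotone Φinv := by
    intro a b hab
    rw [← hmono.le_iff_le, hright, hright]
    exact hab
  have hc : Continuous Φinv := hm.continuous_of_surjective fun t => ⟨_, hleft t⟩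
  rw [Real.exp_neg]
  exact HasDerivAt.of_local_left_inverse hc.continuousAt (Phig_hasDerivAt g hg _)
    (Real.exp_pos _).ne' (Eventually.of_forall hright)

theorem vhess_symm {n : ℕ} (v : (Fin n → ℝ) → ℝ) (x : Fin n → ℝ) (hv : ContDiffAt ℝ 2 v x) :
    (vhess v x).IsSymm := by
  have hd : DifferentiableAt ℝ (fderiv ℝ v) x :=
    (hv.fderiv_right (m := 1) (by norm_num)).differentiableAt (by norm_num)
  have hs : IsSymmSndFDerivAt ℝ v x := hv.isSymmSndFDerivAt (by simp)
  ext i j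
  simp only [vhess, Matrix.transpose_apply, Matrix.of_apply]
  rw [fderiv_clm_apply hd (by fun_prop), fderiv_clm_apply hd (by fun_prop)]
  simpa using hs.eq (Pi.single j 1) (Pi.single i 1)

/-- Theorem 1, reverse direction: if v ∈ C²(Ω) solves
M(x,Dv,D²v) + h(x,v) = 0 with h(x,s) = e^{(α+β+1)G(Φ_g⁻¹(s))} f(x,Φ_g⁻¹(s)),
then u = Φ_g⁻¹ ∘ v solves M(x,Du,D²u) + g(u)N(x,Du,D²u) + f(x,u) = 0. -/
theorem stmt5 {n : ℕ} (Ω : Set (Fin n → ℝ)) (hΩ : IsOpen Ω)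
    (f : (Fin n → ℝ) → ℝ → ℝ)
    (hf : ContinuousOn (fun q : (Fin n → ℝ) × ℝ => f q.1 q.2) (Ω ×ˢ Set.univ))
    (g : ℝ → ℝ) (hg : Continuous g) (hg0 : g0cond g)
    (M N : (Fin n → ℝ) → (Fin n → ℝ) → Matrix (Fin n) (Fin n) ℝ → ℝ)
    (hM : ContinuousOn
      (fun q : (Fin n → ℝ) × (Fin n → ℝ) × Matrix (Fin n) (Fin n) ℝ => M q.1 q.2.1 q.2.2)
      (Ω ×ˢ Set.univ))
    (α : ℝ) (β : ℕ)
    (h1 : ∀ x ∈ Ω, ∀ lam : ℝ, lam ≠ 0 → ∀ (p : Fin n → ℝ) (X : Matrix (Fin n) (Fin n) ℝ),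
      X.IsSymm → M x (lam • p) X = |lam| ^ α * M x p X)
    (h2 : ∀ x ∈ Ω, ∀ (p : Fin n → ℝ) (X : Matrix (Fin n) (Fin n) ℝ), X.IsSymm →
      ∀ γ : ℝ, γ ≠ 0 → ∀ σ : ℝ,
        M x p (γ • X + σ • Matrix.vecMulVec p p)
          = γ ^ (β + 1) * M x p X + σ * γ ^ β * N x p X)
    (Φinv : ℝ → ℝ) (hleft : ∀ t : ℝ, Φinv (Phig g t) = t)
    (hright : ∀ s : ℝ, Phig g (Φinv s) = s)
    (v : (Fin n → ℝ) → ℝ) (hv : ContDiffOn ℝ 2 v Ω)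
    (hsol : ∀ x ∈ Ω,
      M x (vgrad v x) (vhess v x)
        + Real.exp ((α + (β : ℝ) + 1) * Gg g (Φinv (v x))) * f x (Φinv (v x)) = 0) :
    ∀ x ∈ Ω,
      M x (vgrad (Φinv ∘ v) x) (vhess (Φinv ∘ v) x)
        + g ((Φinv ∘ v) x) * N x (vgrad (Φinv ∘ v) x) (vhess (Φinv ∘ v) x)
        + f x ((Φinv ∘ v) x) = 0 := by
  intro x hx
  have hvx : ∀ y ∈ Ω, ContDiffAt ℝ 2 v y := fun y hy => hv.contDiffAt (hΩ.mem_nhds hy)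
  have hud : ∀ y ∈ Ω, HasFDerivAt (Φinv ∘ v)
      (Real.exp (-Gg g (Φinv (v y))) • fderiv ℝ v y) y := fun y hy =>
    (Phinv_hasDerivAt g hg Φinv hleft hright (v y)).comp_hasFDerivAt y
      ((hvx y hy).differentiableAt (by norm_num)).hasFDerivAt
  have hd : DifferentiableAt ℝ (fderiv ℝ v) x :=
    ((hvx x hx).fderiv_right (m := 1) (by norm_num)).differentiableAt (by norm_num)
  set E := Real.exp (Gg g (Φinv (v x))) with hE
  have hE0 : 0 < E := Real.exp_pos _
  have hgrad : vgrad v x = E • vgrad (Φinv ∘ v) x := by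
    ext i
    simp only [vgrad, (hud x hx).fderiv, Pi.smul_apply, _root_.smul_apply,
      smul_eq_mul, Real.exp_neg, ← hE]
    field_simp
  have hhess : vhess v x = E • vhess (Φinv ∘ v) x
      + (E * g (Φinv (v x))) • Matrix.vecMulVec (vgrad (Φinv ∘ v) x) (vgrad (Φinv ∘ v) x) := by
    ext i j
    have hgj := congrFun hgrad j
    simp only [vgrad, Pi.smul_apply, smul_eq_mul] at hgj
    have hev : (fun y => fderiv ℝ (Φinv ∘ v) y (Pi.single j 1)) =ᶠ[nhds x]
        fun y => Real.exp (-Gg g ((Φinv ∘ v) y)) * fderiv ℝ v y (Pi.single j 1) := by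
      filter_upwards [hΩ.mem_nhds hx] with y hy
      rw [(hud y hy).fderiv]
      rfl
    have hA := ((Gg_hasDerivAt g hg ((Φinv ∘ v) x)).comp_hasFDerivAt x
      (hud x hx).differentiableAt.hasFDerivAt).neg.exp
    have hB : DifferentiableAt ℝ (fun y => fderiv ℝ v y (Pi.single j 1)) x :=
      hd.clm_apply (by fun_prop)
    have hC := hev.fderiv_eq.trans (hA.mul hB.hasFDerivAt).fderiv
    simp only [vhess, Matrix.add_apply, Matrix.smul_apply, Matrix.of_apply,
      Matrix.vecMulVec_apply, smul_eq_mul]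
    have hX : Real.exp ((-Gg g ∘ Φinv ∘ v) x) = E⁻¹ := by
      rw [hE, ← Real.exp_neg]
      rfl
    rw [hC, hX]
    simp only [_root_.add_apply, _root_.smul_apply,
      _root_.neg_apply, smul_eq_mul, vgrad, hgj, Function.comp_apply]
    field_simp
    ring
  have hsv := vhess_symm v x (hvx x hx)
  have hsu : (vhess (Φinv ∘ v) x).IsSymm := by
    have : vhess (Φinv ∘ v) x = E⁻¹ • vhess v x
        - g (Φinv (v x)) • Matrix.vecMulVec (vgrad (Φinv ∘ v) x) (vgrad (Φinv ∘ v) x) := by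
      rw [hhess]
      ext i j
      simp only [Matrix.sub_apply, Matrix.add_apply, Matrix.smul_apply, smul_eq_mul]
      field_simp
      ring
    rw [this]
    refine (hsv.smul _).sub (Matrix.IsSymm.smul ?_ _)
    ext i j
    simp [Matrix.vecMulVec_apply, mul_comm]
  have h := hsol x hx
  have hexp : Real.exp ((α + (β : ℝ) + 1) * Gg g (Φinv (v x))) = E ^ α * E ^ (β + 1) := by
    rw [hE, ← Real.exp_mul, ← Real.exp_nat_mul, ← Real.exp_add]
    congr 1
    push_cast
    ring
  rw [hgrad, h1 x hx E hE0.ne' _ _ hsv, hhess, h2 x hx _ _ hsu E hE0.ne', abs_of_pos hE0,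
    hexp] at h
  have hP : E ^ α * E ^ (β + 1) ≠ 0 := by positivity
  apply mul_left_cancel₀ hP
  simp only [Function.comp_apply] at h ⊢
  rw [mul_zero, ← h]
  ring
end

section
/- Let 1 ≤ k ≤ n and let tr_k : Sₙ(ℝ) → ℝ denote the k-trace, tr_k(X) = the sum of all k×k principal minors of X. Then for every X ∈ Sₙ(ℝ), p ∈ ℝⁿ, γ ≠ 0 and σ ∈ ℝ: tr_k(γX + σ(p⊗p)) = γ^k tr_k(X) + σ γ^{k−1} D(tr_k)(X)[p⊗p], where D(tr_k)(X) denotes the Fréchet derivative of tr_k at X (so that D(tr_k)(X)[p⊗p] = Σ_{i,j} (∂tr_k/∂X_{ij})(X) pᵢpⱼ). -/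
open Real

/-- The k-trace: the sum of all k×k principal minors of a matrix. -/
noncomputable def ktrace (n k : ℕ) (X : Matrix (Fin n) (Fin n) ℝ) : ℝ :=
  ∑ S ∈ Finset.univ.powersetCard k,
    (X.submatrix (fun i : {a : Fin n // a ∈ S} => (i : Fin n))
      (fun j : {a : Fin n // a ∈ S} => (j : Fin n))).det

/-- The derivative of the k-trace at X in the direction A, i.e. the Fréchet derivative
D(tr_k)(X)[A] = Σ_{i,j} (∂tr_k/∂X_{ij})(X) A_{ij} (tr_k being a polynomial map, its Fréchet
derivative applied to A equals its directional derivative along A). -/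
noncomputable def ktraceDeriv (n k : ℕ) (X A : Matrix (Fin n) (Fin n) ℝ) : ℝ :=
  deriv (fun t : ℝ => ktrace n k (X + t • A)) 0

theorem det_affine_aux {m : Type*} [Fintype m] [DecidableEq m] (A : Matrix m m ℝ) (u v : m → ℝ) :
    ∃ c : ℝ, ∀ t : ℝ, (A + t • Matrix.vecMulVec u v).det = A.det + t * c := by
  let M : (m ⊕ Unit → ℝ) → Matrix (m ⊕ Unit) (m ⊕ Unit) ℝ := fun r =>
    (Matrix.fromBlocks A (Matrix.of fun i _ => u i) 0 1).updateRow (Sum.inr ()) r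
  have key : ∀ t : ℝ, (A + t • Matrix.vecMulVec u v).det
      = (M (t • Sum.elim (-v) 0 + Sum.elim (0 : m → ℝ) (1 : Unit → ℝ))).det := by
    intro t
    have : M (t • Sum.elim (-v) 0 + Sum.elim (0 : m → ℝ) (1 : Unit → ℝ)) = Matrix.fromBlocks A (Matrix.of fun i _ => u i)
        (Matrix.of fun _ j => -(t * v j)) (1 : Matrix Unit Unit ℝ) := by
      ext i j
      rcases i with i | i <;> rcases j with j | j <;> simp [M, Matrix.updateRow_apply]
    rw [this, Matrix.det_fromBlocks_one₂₂]
    congr 1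
    ext i j
    simp [Matrix.mul_apply, Matrix.vecMulVec_apply]
    ring
  have key2 : ∀ t : ℝ, (A + t • Matrix.vecMulVec u v).det
      = t * (M (Sum.elim (-v) 0)).det + (M (Sum.elim (0 : m → ℝ) (1 : Unit → ℝ))).det := by
    intro t
    rw [key]
    simp only [M]
    rw [Matrix.det_updateRow_add, Matrix.det_updateRow_smul]
  refine ⟨(M (Sum.elim (-v) 0)).det, fun t => ?_⟩
  have h0 := key2 0
  simp only [zero_smul, add_zero, zero_mul, zero_add] at h0
  rw [key2, h0, add_comm]

theorem ktrace_affine_aux (n k : ℕ) (X : Matrix (Fin n) (Fin n) ℝ) (p : Fin n → ℝ) :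
    ∃ c : ℝ, ∀ t : ℝ, ktrace n k (X + t • Matrix.vecMulVec p p) = ktrace n k X + t * c := by
  choose c hc using fun S : Finset (Fin n) => det_affine_aux
    (X.submatrix (fun i : {a : Fin n // a ∈ S} => (i : Fin n))
      (fun j : {a : Fin n // a ∈ S} => (j : Fin n))) (fun i => p i) (fun i => p i)
  refine ⟨∑ S ∈ Finset.univ.powersetCard k, c S, fun t => ?_⟩
  unfold ktrace
  rw [Finset.mul_sum, ← Finset.sum_add_distrib]
  refine Finset.sum_congr rfl fun S _ => ?_
  rw [← hc]
  rfl

theorem ktrace_smul_aux (n k : ℕ) (X : Matrix (Fin n) (Fin n) ℝ) (γ : ℝ) :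
    ktrace n k (γ • X) = γ ^ k * ktrace n k X := by
  unfold ktrace
  rw [Finset.mul_sum]
  refine Finset.sum_congr rfl fun S hS => ?_
  have hS := (Finset.mem_powersetCard.1 hS).2
  rw [Matrix.submatrix_smul, Pi.smul_apply, Pi.smul_apply, Matrix.det_smul, Fintype.card_coe, hS]

/-- for 1 ≤ k ≤ n, X symmetric, p ∈ ℝⁿ, γ ≠ 0 and σ ∈ ℝ:
tr_k(γX + σ(p⊗p)) = γ^k tr_k(X) + σ γ^{k-1} D(tr_k)(X)[p⊗p]. -/
theorem stmt17 {n : ℕ} (k : ℕ) (hk1 : 1 ≤ k) (hkn : k ≤ n) :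
    ∀ (X : Matrix (Fin n) (Fin n) ℝ), X.IsSymm → ∀ (p : Fin n → ℝ) (γ : ℝ), γ ≠ 0 → ∀ σ : ℝ,
      ktrace n k (γ • X + σ • Matrix.vecMulVec p p)
        = γ ^ k * ktrace n k X
          + σ * γ ^ (k - 1) * ktraceDeriv n k X (Matrix.vecMulVec p p) := by
  intro X _ p γ hγ σ
  obtain ⟨c, hc⟩ := ktrace_affine_aux n k X p
  have hd : ktraceDeriv n k X (Matrix.vecMulVec p p) = c := by
    unfold ktraceDeriv
    simp only [hc]
    simpa using (((hasDerivAt_id (0 : ℝ)).mul_const c).const_add (ktrace n k X)).deriv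
  have h1 : γ • X + σ • Matrix.vecMulVec p p = γ • (X + (σ / γ) • Matrix.vecMulVec p p) := by
    rw [smul_add, smul_smul, mul_div_cancel₀ _ hγ]
  rw [h1, ktrace_smul_aux, hc, hd]
  obtain ⟨j, rfl⟩ : ∃ j, k = j + 1 := ⟨k - 1, by omega⟩
  simp only [Nat.add_sub_cancel, pow_succ]
  field_simp
end
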